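/- arXiv:2301.00092 — 2 statements merged into one kernel-verified Lean document; each statement's English description precedes it below -/
import Mathlib

section
/- Consider a probability space carrying random variables S, A (current state and action), S' (next state), and R (reward), a discount factor γ ∈ [0,1), and a Markov (probability) kernel π from the state space to the action space. For a bounded measurable function h on state-action pairs, define the Bellman residual ρ(h) := R − h(S, A) + γ·∫ h(S', x) π(dx | S'), and m(h) := E[ρ(h) | σ(S, A)]. Suppose Q is a bounded measurable function satisfying the Bellman equation m(Q) = 0 almost surely. Then for every bounded measurable h, almost surely m(h) = γ·E[∫ (h − Q)(S', x) π(dx | S') | σ(S, A)] − (h − Q)(S, A) = D(h − Q), where D(v) := γ·E[∫ v(S', x) π(dx | S') | σ(S, A)] − v(S, A). Consequently, for any σ(S, A)-measurable weight Σ bounded above and below by positive constants, E[m(h)²·Σ^{-1}] = E[(D(h − Q))²·Σ^{-1}], i.e. the minimum-distance criterion equals the squared weak norm of h − Q. -/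
open MeasureTheory ProbabilityTheory

/-- The Bellman residual `ρ(h) = R − h(S, A) + γ ∫ h(S', x) π(dx | S')`. -/
noncomputable def bellmanResidual {Ω 𝓢 𝓐 : Type*} [MeasurableSpace 𝓢] [MeasurableSpace 𝓐]
    (St : Ω → 𝓢) (At : Ω → 𝓐) (S' : Ω → 𝓢) (R : Ω → ℝ) (γ : ℝ)
    (π : Kernel 𝓢 𝓐) (h : 𝓢 × 𝓐 → ℝ) : Ω → ℝ :=
  fun ω => R ω - h (St ω, At ω) + γ * ∫ x, h (S' ω, x) ∂(π (S' ω))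

section KernelIntegral

variable {Ω α β : Type*} [MeasurableSpace α] [MeasurableSpace β]

/-- A bounded measurable function on a product is integrable along any section, against a finite
measure. -/
theorem integrable_section_of_bounded (ν : Measure β) [IsFiniteMeasure ν]
    {v : α × β → ℝ} (hv : Measurable v) {C : ℝ} (hC : ∀ p, |v p| ≤ C) (a : α) :
    Integrable (fun x => v (a, x)) ν :=
  .of_bound (hv.comp measurable_prodMk_left).aestronglyMeasurable C
    (.of_forall fun x => hC (a, x))

/-- Integrating a bounded measurable function against a Markov kernel evaluated at a random point
gives an integrable random variable. -/
theorem integrable_integral_kernel_of_bounded {mΩ : MeasurableSpace Ω} (μ : Measure Ω)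
    [IsFiniteMeasure μ] (κ : Kernel α β) [IsMarkovKernel κ] {X : Ω → α} (hX : Measurable X)
    {v : α × β → ℝ} (hv : Measurable v) {C : ℝ} (hC : ∀ p, |v p| ≤ C) :
    Integrable (fun ω => ∫ x, v (X ω, x) ∂(κ (X ω))) μ := by
  have hmeas : StronglyMeasurable fun a => ∫ x, v (a, x) ∂(κ a) :=
    hv.stronglyMeasurable.integral_kernel_prod_right'
  refine .of_bound (hmeas.comp_measurable hX).aestronglyMeasurable C (.of_forall fun ω => ?_)
  simpa using norm_integral_le_of_norm_le_const (μ := κ (X ω)) (f := fun x => v (X ω, x))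
    (.of_forall fun x => hC (X ω, x))

end KernelIntegral

section BellmanResidual

variable {Ω 𝓢 𝓐 : Type*} [MeasurableSpace 𝓢] [MeasurableSpace 𝓐]
  {St : Ω → 𝓢} {At : Ω → 𝓐} {S' : Ω → 𝓢} {R : Ω → ℝ} {π : Kernel 𝓢 𝓐} [IsMarkovKernel π]

/-- The Bellman residual of a bounded measurable function is integrable. -/
theorem integrable_bellmanResidual {mΩ : MeasurableSpace Ω} (μ : Measure Ω) [IsFiniteMeasure μ]
    (hSt : Measurable St) (hAt : Measurable At) (hS' : Measurable S') (hR : Integrable R μ)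
    (γ : ℝ) {h : 𝓢 × 𝓐 → ℝ} (hh : Measurable h) {C : ℝ} (hC : ∀ p, |h p| ≤ C) :
    Integrable (bellmanResidual St At S' R γ π h) μ :=
  (hR.sub (.of_bound (hh.comp (hSt.prodMk hAt)).aestronglyMeasurable C
    (.of_forall fun ω => hC (St ω, At ω)))).add
    ((integrable_integral_kernel_of_bounded μ π hS' hh hC).const_mul γ)

/-- The Bellman residual is affine: its increments do not involve the reward. -/
theorem bellmanResidual_sub_bellmanResidual (γ : ℝ) {h Q : 𝓢 × 𝓐 → ℝ}
    (hh : Measurable h) {C : ℝ} (hC : ∀ p, |h p| ≤ C)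
    (hQ : Measurable Q) {C' : ℝ} (hC' : ∀ p, |Q p| ≤ C') :
    bellmanResidual St At S' R γ π h - bellmanResidual St At S' R γ π Q =
      (γ • fun ω => ∫ x, (h - Q) (S' ω, x) ∂(π (S' ω))) - fun ω => (h - Q) (St ω, At ω) := by
  ext ω
  simp only [bellmanResidual, Pi.sub_apply, Pi.smul_apply, smul_eq_mul]
  rw [integral_sub (integrable_section_of_bounded _ hh hC _)
    (integrable_section_of_bounded _ hQ hC' _)]
  ring

end BellmanResidual

/-- If `Q` is a bounded solution of the Bellman equation
`m(Q) = E[ρ(Q) | σ(S,A)] = 0` a.s., then for every bounded measurable `h`,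
`m(h) = D(h − Q)` a.s., where
`D(v) := γ·E[∫ v(S', x) π(dx|S') | σ(S,A)] − v(S, A)`, and consequently the
minimum-distance criterion `E[m(h)² Σ⁻¹]` equals the squared weak norm
`E[(D(h − Q))² Σ⁻¹]` for any `σ(S,A)`-measurable weight `Σ` bounded above and below by
positive constants. -/
theorem bellman_moment_equals_weak_norm
    {Ω 𝓢 𝓐 : Type*} {mΩ : MeasurableSpace Ω} [MeasurableSpace 𝓢] [MeasurableSpace 𝓐]
    (μ : Measure Ω) [IsProbabilityMeasure μ]
    (St : Ω → 𝓢) (At : Ω → 𝓐) (S' : Ω → 𝓢) (R : Ω → ℝ)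
    (hSt : Measurable St) (hAt : Measurable At) (hS' : Measurable S') (hR : Measurable R)
    (hR_bdd : ∃ C, ∀ ω, |R ω| ≤ C)
    (γ : ℝ) (hγ0 : 0 ≤ γ) (hγ1 : γ < 1)
    (π : Kernel 𝓢 𝓐) [IsMarkovKernel π]
    (G : MeasurableSpace Ω)
    (hG : G = MeasurableSpace.comap (fun ω => (St ω, At ω)) inferInstance)
    (m : (𝓢 × 𝓐 → ℝ) → Ω → ℝ)
    (hm : ∀ h, m h = μ[bellmanResidual St At S' R γ π h | G])
    (D : (𝓢 × 𝓐 → ℝ) → Ω → ℝ)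
    (hD : ∀ v, D v = fun ω =>
      γ * (μ[fun ω' => ∫ x, v (S' ω', x) ∂(π (S' ω')) | G]) ω - v (St ω, At ω))
    (Q : 𝓢 × 𝓐 → ℝ) (hQ_meas : Measurable Q) (hQ_bdd : ∃ C, ∀ p, |Q p| ≤ C)
    (hBellman : m Q =ᵐ[μ] 0)
    (Sw : Ω → ℝ) (hSw_meas : Measurable[G] Sw)
    (c C : ℝ) (hc : 0 < c) (hSw_bdd : ∀ ω, c ≤ Sw ω ∧ Sw ω ≤ C)
    (h : 𝓢 × 𝓐 → ℝ) (hh_meas : Measurable h) (hh_bdd : ∃ C', ∀ p, |h p| ≤ C') :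
    m h =ᵐ[μ] D (h - Q) ∧
      ∫ ω, (m h ω) ^ 2 * (Sw ω)⁻¹ ∂μ = ∫ ω, (D (h - Q) ω) ^ 2 * (Sw ω)⁻¹ ∂μ := by
  obtain ⟨CR, hCR⟩ := hR_bdd
  obtain ⟨CQ, hCQ⟩ := hQ_bdd
  obtain ⟨Ch, hCh⟩ := hh_bdd
  have hSA : Measurable[mΩ] fun ω => (St ω, At ω) := hSt.prodMk hAt
  have hGle : G ≤ mΩ := hG ▸ hSA.comap_le
  have hR_int : Integrable R μ := .of_bound hR.aestronglyMeasurable CR (.of_forall hCR)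
  have hv_meas : Measurable (h - Q) := hh_meas.sub hQ_meas
  have hv_bdd : ∀ p, |(h - Q) p| ≤ Ch + CQ := fun p =>
    (abs_sub _ _).trans (add_le_add (hCh p) (hCQ p))
  have hv_int : Integrable (fun ω => (h - Q) (St ω, At ω)) μ :=
    .of_bound (hv_meas.comp hSA).aestronglyMeasurable _ (.of_forall fun ω => hv_bdd _)
  have hv_G : StronglyMeasurable[G] fun ω => (h - Q) (St ω, At ω) := by
    subst hG
    exact (hv_meas.comp (comap_measurable _)).stronglyMeasurable
  have hmD : m h =ᵐ[μ] D (h - Q) := by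
    rw [hm] at hBellman
    rw [hm, hD]
    have hsub := condExp_sub (integrable_bellmanResidual (π := π) μ hSt hAt hS' hR_int γ hh_meas hCh)
      (integrable_bellmanResidual (π := π) μ hSt hAt hS' hR_int γ hQ_meas hCQ) G
    rw [bellmanResidual_sub_bellmanResidual γ hh_meas hCh hQ_meas hCQ] at hsub
    have hsub' := condExp_sub
      ((integrable_integral_kernel_of_bounded μ π hS' hv_meas hv_bdd).smul γ) hv_int G
    rw [condExp_of_stronglyMeasurable hGle hv_G hv_int] at hsub'
    filter_upwards [hBellman, hsub, hsub',
      condExp_smul γ (fun ω => ∫ x, (h - Q) (S' ω, x) ∂(π (S' ω))) G] with ω hB h₁ h₂ h₃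
    simp only [Pi.sub_apply, Pi.smul_apply, Pi.zero_apply, smul_eq_mul] at hB h₁ h₂ h₃ ⊢
    linarith
  refine ⟨hmD, integral_congr_ae ?_⟩
  filter_upwards [hmD] with ω hω
  rw [hω]
end

section
/- Let (Ω, F, P) be a probability space, X, W random vectors, U : Ω → ℝ a random variable, and C > 0. Suppose that for almost every value (x, w) of (X, W), the conditional distribution of U given (X, W) = (x, w) admits a density bounded by C with respect to Lebesgue measure. Let ω > 0, δ > 0, let a ≥ 0 be a bounded measurable function, and let g₁, g₂ be measurable functions with ‖g₁ − g₂‖_{∞,ω} ≤ δ, where ‖h‖_{∞,ω} := sup_s |h(s)|·(1+‖s‖²)^{−ω/2}. If a(X)·(1 + ‖W‖²)^{ω/2} is integrable, then E[a(X)·(1{U ≤ g₁(W)} − 1{U ≤ g₂(W)})²] ≤ C·δ·E[a(X)·(1 + ‖W‖²)^{ω/2}]. -/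
open MeasureTheory ProbabilityTheory

/-- The squared difference of two half-line indicators is the indicator of the interval between
the endpoints. -/
lemma sq_indicator_Iic_sub_indicator_Iic (b c u : ℝ) :
    (Set.indicator (Set.Iic b) (fun _ => (1 : ℝ)) u -
      Set.indicator (Set.Iic c) (fun _ => (1 : ℝ)) u) ^ 2 =
      Set.indicator (Set.uIoc b c) (fun _ => (1 : ℝ)) u := by
  classical
  rw [Set.indicator_apply, Set.indicator_apply, Set.indicator_apply]
  simp only [Set.mem_Iic, Set.mem_uIoc]
  grind

/-- A measure with Lebesgue density bounded by `C` gives the interval between `b` and `c` mass at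
most `C * |b - c|`. -/
lemma withDensity_uIoc_le {f : ℝ → ℝ} {C : ℝ} (hC : 0 ≤ C) (hf : ∀ u, f u ≤ C) (b c : ℝ) :
    (volume.withDensity fun u => ENNReal.ofReal (f u)) (Set.uIoc b c) ≤
      ENNReal.ofReal (C * |b - c|) := by
  rw [withDensity_apply _ measurableSet_uIoc]
  calc ∫⁻ u in Set.uIoc b c, ENNReal.ofReal (f u)
      ≤ ∫⁻ _ in Set.uIoc b c, ENNReal.ofReal C :=
        lintegral_mono fun u => ENNReal.ofReal_le_ofReal (hf u)
    _ = ENNReal.ofReal (C * |b - c|) := by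
        rw [setLIntegral_const, Real.volume_uIoc, ENNReal.ofReal_mul hC, abs_sub_comm]

/-- In the NPQIV setting, if the conditional distribution `κ (x, w)` of
`U` given `(X, W) = (x, w)` admits a Lebesgue density bounded by `C` for a.e. `(x, w)`,
`a ≥ 0` is bounded measurable, and `‖g₁ − g₂‖_{∞,ω} ≤ δ` (so that
`|g₁(W) − g₂(W)| ≤ δ(1 + ‖W‖²)^{ω/2}`), then
`E[a(X)·(1{U ≤ g₁(W)} − 1{U ≤ g₂(W)})²] ≤ C·δ·E[a(X)·(1 + ‖W‖²)^{ω/2}]`. -/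
theorem npqiv_indicator_increment_bound
    {Ω : Type*} {mΩ : MeasurableSpace Ω} (μ : Measure Ω) [IsProbabilityMeasure μ]
    (k d : ℕ) (X : Ω → (Fin k → ℝ)) (W : Ω → (Fin d → ℝ)) (U : Ω → ℝ)
    (hX : Measurable X) (hW : Measurable W) (hU : Measurable U)
    (C : ℝ) (hC : 0 < C)
    (κ : Kernel ((Fin k → ℝ) × (Fin d → ℝ)) ℝ) [IsMarkovKernel κ]
    (hκ : μ.map (fun ω => ((X ω, W ω), U ω)) =
      (μ.map (fun ω => (X ω, W ω))).compProd κ)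
    (hdens : ∀ᵐ p ∂(μ.map (fun ω => (X ω, W ω))),
      ∃ f : ℝ → ℝ, Measurable f ∧ (∀ u, 0 ≤ f u ∧ f u ≤ C) ∧
        κ p = volume.withDensity (fun u => ENNReal.ofReal (f u)))
    (w δ : ℝ) (hw : 0 < w) (hδ : 0 < δ)
    (a : (Fin k → ℝ) → ℝ) (ha_meas : Measurable a)
    (ha_nonneg : ∀ x, 0 ≤ a x) (ha_bdd : ∃ M, ∀ x, a x ≤ M)
    (g₁ g₂ : (Fin d → ℝ) → ℝ) (hg₁ : Measurable g₁) (hg₂ : Measurable g₂)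
    (hgap : ∀ s, |g₁ s - g₂ s| ≤ δ * (1 + ‖s‖ ^ 2) ^ (w / 2))
    (hint : Integrable (fun ω => a (X ω) * (1 + ‖W ω‖ ^ 2) ^ (w / 2)) μ) :
    ∫ ω, a (X ω) *
        (Set.indicator (Set.Iic (g₁ (W ω))) (fun _ => (1 : ℝ)) (U ω) -
          Set.indicator (Set.Iic (g₂ (W ω))) (fun _ => (1 : ℝ)) (U ω)) ^ 2 ∂μ ≤
      C * δ * ∫ ω, a (X ω) * (1 + ‖W ω‖ ^ 2) ^ (w / 2) ∂μ := by
  simp only [sq_indicator_Iic_sub_indicator_Iic]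
  have hXW : Measurable fun ω => (X ω, W ω) := hX.prodMk hW
  have hset : MeasurableSet
      {z : ((Fin k → ℝ) × (Fin d → ℝ)) × ℝ | z.2 ∈ Set.uIoc (g₁ z.1.2) (g₂ z.1.2)} := by
    simp only [Set.mem_uIoc]
    have h₁ : Measurable fun z : ((Fin k → ℝ) × (Fin d → ℝ)) × ℝ => g₁ z.1.2 := by fun_prop
    have h₂ : Measurable fun z : ((Fin k → ℝ) × (Fin d → ℝ)) × ℝ => g₂ z.1.2 := by fun_prop
    exact ((measurableSet_lt h₁ measurable_snd).inter (measurableSet_le measurable_snd h₂)).union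
      ((measurableSet_lt h₂ measurable_snd).inter (measurableSet_le measurable_snd h₁))
  let F : ((Fin k → ℝ) × (Fin d → ℝ)) × ℝ → ℝ := fun z =>
    a z.1.1 * Set.indicator (Set.uIoc (g₁ z.1.2) (g₂ z.1.2)) (fun _ => (1 : ℝ)) z.2
  have hF : Measurable F := by
    refine Measurable.mul (by fun_prop) ?_
    exact (measurable_const (a := (1 : ℝ))).indicator hset
  let G : (Fin k → ℝ) × (Fin d → ℝ) → ℝ := fun p =>
    C * δ * (a p.1 * (1 + ‖p.2‖ ^ 2) ^ (w / 2))
  have hG : Measurable G := by fun_prop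
  have hG_nonneg : ∀ p, 0 ≤ G p := fun p => by
    have := ha_nonneg p.1
    positivity
  have key : ∫⁻ ω, ENNReal.ofReal (F ((X ω, W ω), U ω)) ∂μ ≤
      ∫⁻ ω, ENNReal.ofReal (G (X ω, W ω)) ∂μ := by
    rw [← lintegral_map (f := fun z => ENNReal.ofReal (F z)) hF.ennreal_ofReal (hXW.prodMk hU), hκ,
      Measure.lintegral_compProd hF.ennreal_ofReal,
      ← lintegral_map (f := fun p => ENNReal.ofReal (G p)) hG.ennreal_ofReal hXW]
    refine lintegral_mono_ae ?_
    filter_upwards [hdens] with p hp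
    obtain ⟨f, -, hf, hκp⟩ := hp
    have hrw : ∀ u, ENNReal.ofReal (F (p, u)) = ENNReal.ofReal (a p.1) *
        Set.indicator (Set.uIoc (g₁ p.2) (g₂ p.2)) 1 u := fun u => by
      by_cases hu : u ∈ Set.uIoc (g₁ p.2) (g₂ p.2) <;> simp [F, hu]
    simp only [hrw]
    rw [lintegral_const_mul _ (measurable_one.indicator measurableSet_uIoc),
      lintegral_indicator_one measurableSet_uIoc, hκp]
    calc _ ≤ ENNReal.ofReal (a p.1) * ENNReal.ofReal (C * |g₁ p.2 - g₂ p.2|) := by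
          gcongr
          exact withDensity_uIoc_le hC.le (fun u => (hf u).2) _ _
      _ = ENNReal.ofReal (a p.1 * (C * |g₁ p.2 - g₂ p.2|)) :=
          (ENNReal.ofReal_mul (ha_nonneg _)).symm
      _ ≤ ENNReal.ofReal (a p.1 * (C * (δ * (1 + ‖p.2‖ ^ 2) ^ (w / 2)))) := by
          have := ha_nonneg p.1
          have := hgap p.2
          gcongr
      _ = ENNReal.ofReal (G p) := by
          congr 1
          simp only [G]
          ring
  have hGint : Integrable (fun ω => G (X ω, W ω)) μ := hint.const_mul (C * δ)
  rw [← integral_const_mul]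
  change ∫ ω, F ((X ω, W ω), U ω) ∂μ ≤ ∫ ω, G (X ω, W ω) ∂μ
  rw [integral_eq_lintegral_of_nonneg_ae
      (ae_of_all _ fun ω => mul_nonneg (ha_nonneg _) (Set.indicator_nonneg (by simp) _))
      (hF.comp (hXW.prodMk hU)).aestronglyMeasurable,
    integral_eq_lintegral_of_nonneg_ae (ae_of_all _ fun ω => hG_nonneg _)
      hGint.aestronglyMeasurable]
  exact ENNReal.toReal_mono hGint.lintegral_lt_top.ne key
end
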